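/- For every countable collection of languages 𝓛 : ℕ → Set ℕ (each 𝓛 i infinite) there exists a set-based generator G : List ℕ → Set ℕ (not depending on c) such that for every c ∈ [0,1], every index i, and every enumeration x of K := 𝓛 i with finite noise and c-omissions: (generation) there exists n* such that G(x_1,…,x_n) ⊆ K \ {x_1,…,x_n} for all n ≥ n*; and (density) limsup_{n→∞} μ_low(G(x_1,…,x_n), K) ≥ 1 − c. In particular, under finite noise and finite omissions the generator achieves set-based upper density 1. -/

import Mathlib

open Filter Set Topology

/-- The list `[x 0, …, x (n-1)]` of the first `n` elements of the stream `x`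
(the paper's `x_1, …, x_n`). -/
def prefixList (x : ℕ → ℕ) (n : ℕ) : List ℕ := (List.range n).map x

/-- The set of the first `n` elements of the stream `x` (the paper's `{x_1, …, x_n}`). -/
def seen (x : ℕ → ℕ) (n : ℕ) : Set ℕ := x '' {t | t < n}

/-- The empirical noise rate `R(L; x_{1:n})` of the first `n` elements of `x` w.r.t. `L`. -/
noncomputable def noiseRate (L : Set ℕ) (x : ℕ → ℕ) (n : ℕ) : ℝ :=
  (({t | t < n ∧ x t ∉ L}).ncard : ℝ) / n

/-- `|A ∩ {b_1, …, b_m}| / m` where `b_1 < b_2 < …` is the increasing enumeration of `B`. -/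
noncomputable def densityRatio (A B : Set ℕ) (m : ℕ) : ℝ :=
  (({j | j < m ∧ Nat.nth (· ∈ B) j ∈ A}).ncard : ℝ) / m

/-- Lower density `μ_low(A, B)` of `A` in `B`. -/
noncomputable def lowDensity (A B : Set ℕ) : ℝ := Filter.liminf (densityRatio A B) Filter.atTop

/-- Upper density `μ_up(A, B)` of `A` in `B`. -/
noncomputable def upDensity (A B : Set ℕ) : ℝ := Filter.limsup (densityRatio A B) Filter.atTop

/-- Every element of the list `l` lies in `L`. -/
def ConsistentWith (L : Set ℕ) (l : List ℕ) : Prop := ∀ a ∈ l, a ∈ L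

/-- The index `k` is below the length of `l`, and the last element of `l` refutes none of the
languages `M 0, …, M k`. -/
def IsTrusted (M : ℕ → Set ℕ) (l : List ℕ) (k : ℕ) : Prop :=
  k < l.length ∧ ∀ j ≤ k, ConsistentWith (M j) l.dropLast → ConsistentWith (M j) l

/-- The generator that outputs the unseen elements of the intersection of all consistent
languages with a trusted index. -/
def trustedInter (M : ℕ → Set ℕ) (l : List ℕ) : Set ℕ :=
  {a | a ∉ l ∧ ∀ k, IsTrusted M l k → ConsistentWith (M k) l → a ∈ M k}

lemma mem_prefixList {x : ℕ → ℕ} {n a : ℕ} : a ∈ prefixList x n ↔ a ∈ seen x n := by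
  simp [prefixList, seen]

lemma length_prefixList (x : ℕ → ℕ) (n : ℕ) : (prefixList x n).length = n := by
  simp [prefixList]

lemma dropLast_prefixList_succ (x : ℕ → ℕ) (n : ℕ) :
    (prefixList x (n + 1)).dropLast = prefixList x n := by
  simp [prefixList, List.range_succ]

lemma consistentWith_prefixList {L : Set ℕ} {x : ℕ → ℕ} {n : ℕ} :
    ConsistentWith L (prefixList x n) ↔ ∀ t < n, x t ∈ L := by
  simp [ConsistentWith, prefixList]

lemma finite_seen (x : ℕ → ℕ) (n : ℕ) : (seen x n).Finite :=
  (Set.finite_lt_nat n).image x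

lemma IsTrusted.mono {M : ℕ → Set ℕ} {l : List ℕ} {j k : ℕ} (h : IsTrusted M l k) (hjk : j ≤ k) :
    IsTrusted M l j :=
  ⟨hjk.trans_lt h.1, fun i hi => h.2 i (hi.trans hjk)⟩

lemma eventually_isTrusted (M : ℕ → Set ℕ) (x : ℕ → ℕ) (k : ℕ) :
    ∀ᶠ n in atTop, IsTrusted M (prefixList x n) k := by
  have key : ∀ j, ∀ᶠ n in atTop, ConsistentWith (M j) (prefixList x n).dropLast →
      ConsistentWith (M j) (prefixList x n) := by
    intro j
    by_cases h : ∀ t, x t ∈ M j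
    · exact Eventually.of_forall fun n _ => consistentWith_prefixList.2 fun t _ => h t
    · push Not at h
      obtain ⟨t, ht⟩ := h
      filter_upwards [eventually_ge_atTop (t + 2)] with n hn hc
      obtain ⟨m, rfl⟩ : ∃ m, n = m + 1 := ⟨n - 1, by omega⟩
      rw [dropLast_prefixList_succ, consistentWith_prefixList] at hc
      exact absurd (hc t (by omega)) ht
  have hall : ∀ᶠ n in atTop, ∀ j ∈ Set.Iic k,
      ConsistentWith (M j) (prefixList x n).dropLast → ConsistentWith (M j) (prefixList x n) :=
    (eventually_all_finite (Set.finite_Iic k)).2 fun j _ => key j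
  filter_upwards [hall, eventually_gt_atTop k] with n h hn
  exact ⟨by rwa [length_prefixList], h⟩

/-- At infinitely many times, all consistent languages with a trusted index contain the whole
stream. -/
lemma frequently_forall_isTrusted (M : ℕ → Set ℕ) (x : ℕ → ℕ) :
    ∃ᶠ n in atTop, ∀ k, IsTrusted M (prefixList x n) k →
      ConsistentWith (M k) (prefixList x n) → Set.range x ⊆ M k := by
  rw [frequently_atTop]
  intro N
  let p : ℕ → ℕ := fun n => sInf {k | ¬ IsTrusted M (prefixList x n) k}
  obtain ⟨n, hn, hmin⟩ : ∃ n, N ≤ n ∧ ∀ m, N ≤ m → p n ≤ p m := by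
    obtain ⟨n, h⟩ := exists_minimalFor_of_wellFoundedLT (N ≤ ·) p ⟨N, le_rfl⟩
    exact ⟨n, h.prop, fun m hm => (le_total (p n) (p m)).elim id (h.le_of_le hm)⟩
  refine ⟨n, hn, fun k hk hc => ?_⟩
  have hkp : k < p n := by
    by_contra! hle
    have hmem : p n ∈ {k | ¬ IsTrusted M (prefixList x n) k} :=
      Nat.sInf_mem ⟨n, fun h => (h.1.trans_eq (length_prefixList x n)).false⟩
    exact hmem (hk.mono hle)
  have htrust : ∀ m ≥ n, IsTrusted M (prefixList x m) k := fun m hm =>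
    not_not.1 (Nat.notMem_of_lt_sInf (hkp.trans_le (hmin m (hn.trans hm))))
  have hcons : ∀ m ≥ n, ConsistentWith (M k) (prefixList x m) := by
    intro m hm
    induction m, hm using Nat.le_induction with
    | base => exact hc
    | succ m hm ih =>
      exact (htrust (m + 1) (by omega)).2 k le_rfl (by rwa [dropLast_prefixList_succ])
  rintro _ ⟨t, rfl⟩
  exact consistentWith_prefixList.1 (hcons (max n (t + 1)) (le_max_left _ _)) t
    (by omega)

lemma finite_densityIndices (A B : Set ℕ) (m : ℕ) :
    {j | j < m ∧ Nat.nth (· ∈ B) j ∈ A}.Finite :=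
  (Set.finite_lt_nat m).subset fun _ h => h.1

lemma densityRatio_nonneg (A B : Set ℕ) (m : ℕ) : 0 ≤ densityRatio A B m := by
  unfold densityRatio; positivity

lemma densityRatio_le_one (A B : Set ℕ) (m : ℕ) : densityRatio A B m ≤ 1 := by
  refine div_le_one_of_le₀ ?_ (Nat.cast_nonneg m)
  have hsub : {j | j < m ∧ Nat.nth (· ∈ B) j ∈ A} ⊆ (Finset.range m : Set ℕ) :=
    fun j h => Finset.mem_coe.2 (Finset.mem_range.2 h.1)
  have h := Set.ncard_le_ncard hsub (Finset.finite_toSet _)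
  rw [Set.ncard_coe_finset, Finset.card_range] at h
  exact_mod_cast h

lemma isBoundedUnder_ge_densityRatio (A B : Set ℕ) :
    IsBoundedUnder (· ≥ ·) atTop (densityRatio A B) :=
  isBoundedUnder_of ⟨0, densityRatio_nonneg A B⟩

lemma isCoboundedUnder_ge_densityRatio (A B : Set ℕ) :
    IsCoboundedUnder (· ≥ ·) atTop (densityRatio A B) :=
  (isBoundedUnder_of ⟨1, densityRatio_le_one A B⟩ :
    IsBoundedUnder (· ≤ ·) atTop (densityRatio A B)).isCoboundedUnder_ge

lemma lowDensity_le_one (A B : Set ℕ) : lowDensity A B ≤ 1 :=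
  liminf_le_of_frequently_le (Frequently.of_forall (densityRatio_le_one A B))
    (isBoundedUnder_ge_densityRatio A B)

lemma densityRatio_le_add {A A' B : Set ℕ} (hB : B.Infinite) (h : (A \ A').Finite) (m : ℕ) :
    densityRatio A B m ≤ densityRatio A' B m + (A \ A').ncard / m := by
  unfold densityRatio
  rw [← add_div]
  gcongr
  have hinj : Function.Injective (Nat.nth (· ∈ B)) := Nat.nth_injective hB
  have hsub : {j | j < m ∧ Nat.nth (· ∈ B) j ∈ A} ⊆
      {j | j < m ∧ Nat.nth (· ∈ B) j ∈ A'} ∪ Nat.nth (· ∈ B) ⁻¹' (A \ A') := by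
    rintro j ⟨hj, hA⟩
    by_cases hA' : Nat.nth (· ∈ B) j ∈ A'
    · exact Or.inl ⟨hj, hA'⟩
    · exact Or.inr ⟨hA, hA'⟩
  have hfin : (Nat.nth (· ∈ B) ⁻¹' (A \ A')).Finite := h.preimage hinj.injOn
  have hcard : (Nat.nth (· ∈ B) ⁻¹' (A \ A')).ncard ≤ (A \ A').ncard := by
    rw [← Set.ncard_image_of_injective _ hinj]
    exact Set.ncard_le_ncard (Set.image_preimage_subset _ _) h
  have := (Set.ncard_le_ncard hsub ((finite_densityIndices A' B m).union hfin)).trans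
    (Set.ncard_union_le _ _)
  exact_mod_cast this.trans (Nat.add_le_add_left hcard _)

lemma lowDensity_le_of_diff_finite {A A' B : Set ℕ} (hB : B.Infinite) (h : (A \ A').Finite) :
    lowDensity A B ≤ lowDensity A' B := by
  refine le_of_forall_pos_le_add fun ε hε => ?_
  rw [← sub_le_iff_le_add]
  refine le_liminf_of_le (isCoboundedUnder_ge_densityRatio A' B) ?_
  have h1 : ∀ᶠ m in atTop, lowDensity A B - ε / 2 < densityRatio A B m :=
    eventually_lt_of_lt_liminf (by unfold lowDensity; linarith)
      (isBoundedUnder_ge_densityRatio A B)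
  have h2 : ∀ᶠ m : ℕ in atTop, ((A \ A').ncard : ℝ) / m < ε / 2 :=
    (tendsto_const_div_atTop_nhds_zero_nat _).eventually_lt_const (half_pos hε)
  filter_upwards [h1, h2] with m h1 h2
  linarith [densityRatio_le_add hB h m]

lemma one_le_lowDensity_self {B : Set ℕ} (hB : B.Infinite) : 1 ≤ lowDensity B B := by
  refine le_liminf_of_le (isCoboundedUnder_ge_densityRatio B B) ?_
  filter_upwards [eventually_gt_atTop 0] with m hm
  have hset : {j | j < m ∧ Nat.nth (· ∈ B) j ∈ B} = Set.Iio m := by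
    ext j
    exact ⟨fun h => h.1, fun h => ⟨h, Nat.nth_mem_of_infinite hB j⟩⟩
  have hm' : (m : ℝ) ≠ 0 := by positivity
  rw [densityRatio, hset, ← Finset.coe_Iio, Set.ncard_coe_finset, Nat.card_Iio, div_self hm']

/-- If `M` lists all finite enlargements of the language `K`, then the generator `trustedInter M`
generates in the limit from `K` under finite noise. -/
lemma exists_forall_trustedInter_subset {M : ℕ → Set ℕ} {K : Set ℕ} {x : ℕ → ℕ}
    (hM : ∃ k, M k = K ∪ (Set.range x \ K)) (hnoise : (Set.range x \ K).Finite) :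
    ∃ nstar : ℕ, ∀ n ≥ nstar, trustedInter M (prefixList x n) ⊆ K \ seen x n := by
  obtain ⟨k, hk⟩ := hM
  have hseen : ∀ᶠ n in atTop, ∀ a ∈ Set.range x \ K, a ∈ seen x n := by
    refine (eventually_all_finite hnoise).2 ?_
    rintro _ ⟨⟨t, rfl⟩, -⟩
    filter_upwards [eventually_gt_atTop t] with n hn
    exact ⟨t, hn, rfl⟩
  obtain ⟨N, hN⟩ := eventually_atTop.1 (hseen.and (eventually_isTrusted M x k))
  refine ⟨N, fun n hn a ha => ?_⟩
  obtain ⟨hs, ht⟩ := hN n hn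
  have hns : a ∉ seen x n := fun h => ha.1 (mem_prefixList.2 h)
  have hcons : ConsistentWith (M k) (prefixList x n) := by
    rw [consistentWith_prefixList, hk, Set.union_sdiff_self]
    exact fun t _ => Or.inr ⟨t, rfl⟩
  have hmem := ha.2 k ht hcons
  rw [hk] at hmem
  exact ⟨hmem.resolve_right fun h => hns (hs a h), hns⟩

lemma lowDensity_le_limsup_trustedInter (M : ℕ → Set ℕ) {K : Set ℕ} (hK : K.Infinite)
    (x : ℕ → ℕ) :
    lowDensity (Set.range x ∩ K) K ≤
      limsup (fun n => lowDensity (trustedInter M (prefixList x n)) K) atTop := by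
  refine le_limsup_of_frequently_le ?_ (isBoundedUnder_of ⟨1, fun n => lowDensity_le_one _ _⟩)
  refine (frequently_forall_isTrusted M x).mono fun n hn => ?_
  refine lowDensity_le_of_diff_finite hK ((finite_seen x n).subset ?_)
  rintro a ⟨ha, hnot⟩
  by_contra hs
  exact hnot ⟨fun h => hs (mem_prefixList.1 h), fun k ht hc => hn k ht hc ha.1⟩

/-- The finite enlargements of the languages of a countable collection can be listed. -/
lemma exists_listing_finite_enlargements (𝓛 : ℕ → Set ℕ) :
    ∃ M : ℕ → Set ℕ, ∀ i (F : Set ℕ), F.Finite → ∃ k, M k = 𝓛 i ∪ F := by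
  obtain ⟨e, he⟩ := exists_surjective_nat (ℕ × Finset ℕ)
  refine ⟨fun k => 𝓛 (e k).1 ∪ (e k).2, fun i F hF => ?_⟩
  obtain ⟨k, hk⟩ := he (i, hF.toFinset)
  exact ⟨k, by simp [hk]⟩

/-- Under finite noise and `c`-omissions, some set-based generator generates in the limit
with set-based upper density at least `1 - c`; in particular, under finite noise and
finite omissions it achieves set-based upper density `1`. -/
theorem set_based_upper_density_finite_noise (𝓛 : ℕ → Set ℕ) (hinf : ∀ i, (𝓛 i).Infinite) :
    ∃ G : List ℕ → Set ℕ,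
      (∀ c ∈ Set.Icc (0:ℝ) 1, ∀ i : ℕ, ∀ x : ℕ → ℕ,
        Function.Injective x →
        (Set.range x \ 𝓛 i).Finite →
        lowDensity (Set.range x ∩ 𝓛 i) (𝓛 i) ≥ 1 - c →
        (∃ nstar : ℕ, ∀ n ≥ nstar, G (prefixList x n) ⊆ 𝓛 i \ seen x n) ∧
        Filter.limsup (fun n => lowDensity (G (prefixList x n)) (𝓛 i)) Filter.atTop ≥ 1 - c) ∧
      (∀ i : ℕ, ∀ x : ℕ → ℕ,
        Function.Injective x →
        (Set.range x \ 𝓛 i).Finite → (𝓛 i \ Set.range x).Finite →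
        (∃ nstar : ℕ, ∀ n ≥ nstar, G (prefixList x n) ⊆ 𝓛 i \ seen x n) ∧
        Filter.limsup (fun n => lowDensity (G (prefixList x n)) (𝓛 i)) Filter.atTop ≥ 1) := by
  obtain ⟨M, hM⟩ := exists_listing_finite_enlargements 𝓛
  refine ⟨trustedInter M, fun c _ i x _ hnoise hdens => ?_, fun i x _ hnoise homit => ?_⟩
  · exact ⟨exists_forall_trustedInter_subset (hM i _ hnoise) hnoise,
      hdens.trans (lowDensity_le_limsup_trustedInter M (hinf i) x)⟩
  · have hdens : 1 ≤ lowDensity (Set.range x ∩ 𝓛 i) (𝓛 i) :=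
      (one_le_lowDensity_self (hinf i)).trans
        (lowDensity_le_of_diff_finite (hinf i) (by rwa [Set.sdiff_inter_self_eq_sdiff]))
    exact ⟨exists_forall_trustedInter_subset (hM i _ hnoise) hnoise,
      hdens.trans (lowDensity_le_limsup_trustedInter M (hinf i) x)⟩
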